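/- Suppose (x^k)_{k∈K} is a sequence of vectors in ℝ^m converging to z, where z is a global minimizer of the continuous relaxation problem. If ‖z‖₀ > n and |J_i(z)| = 1 for every block index i, then there exist an integer k₀ > 0 and a global minimizer x* of the CPD integer problem such that for all k ≥ k₀ with k ∈ K, the per-block argmax set J(x^k) equals the support Γ(x*). -/

import Mathlib

open Finset Filter

noncomputable section

/-- The QSAP objective `f(x) = (1/2) xᵀBx + aᵀx` written blockwise. -/
def qsapF {n : ℕ} {l : Fin n → ℕ}
    (a : (i : Fin n) → Fin (l i) → ℝ)
    (B : (i : Fin n) → (j : Fin n) → Matrix (Fin (l i)) (Fin (l j)) ℝ)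
    (x : (i : Fin n) → Fin (l i) → ℝ) : ℝ :=
  (1 / 2) * (∑ i, ∑ j, ∑ r, ∑ s, B i j r s * x i r * x j s)
    + ∑ i, ∑ r, a i r * x i r

/-- Feasibility for the continuous relaxation: each block sums to one, entries nonnegative. -/
def RelaxFeas {n : ℕ} {l : Fin n → ℕ} (x : (i : Fin n) → Fin (l i) → ℝ) : Prop :=
  (∀ i, ∑ r, x i r = 1) ∧ ∀ i r, 0 ≤ x i r

/-- Feasibility for the CPD integer problem: each block sums to one, entries in {0,1}. -/
def IntFeas {n : ℕ} {l : Fin n → ℕ} (x : (i : Fin n) → Fin (l i) → ℝ) : Prop :=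
  (∀ i, ∑ r, x i r = 1) ∧ ∀ i r, x i r = 0 ∨ x i r = 1

/-- Global minimizer of the continuous relaxation. -/
def IsRelaxMin {n : ℕ} {l : Fin n → ℕ}
    (a : (i : Fin n) → Fin (l i) → ℝ)
    (B : (i : Fin n) → (j : Fin n) → Matrix (Fin (l i)) (Fin (l j)) ℝ)
    (x : (i : Fin n) → Fin (l i) → ℝ) : Prop :=
  RelaxFeas x ∧ ∀ y, RelaxFeas y → qsapF a B x ≤ qsapF a B y

/-- Global minimizer of the CPD integer problem. -/
def IsIntMin {n : ℕ} {l : Fin n → ℕ}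
    (a : (i : Fin n) → Fin (l i) → ℝ)
    (B : (i : Fin n) → (j : Fin n) → Matrix (Fin (l i)) (Fin (l j)) ℝ)
    (x : (i : Fin n) → Fin (l i) → ℝ) : Prop :=
  IntFeas x ∧ ∀ y, IntFeas y → qsapF a B x ≤ qsapF a B y

/-- `‖x‖₀`, the number of nonzero entries of `x`. -/
def norm0 {n : ℕ} {l : Fin n → ℕ} (x : (i : Fin n) → Fin (l i) → ℝ) : ℕ :=
  Set.ncard {p : Σ i : Fin n, Fin (l i) | x p.1 p.2 ≠ 0}

/-- The support `Γ(x) = {(i,r) : x^{(i)}_r > 0}`. -/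
def supp {n : ℕ} {l : Fin n → ℕ} (x : (i : Fin n) → Fin (l i) → ℝ) :
    Set (Σ i : Fin n, Fin (l i)) :=
  {p | 0 < x p.1 p.2}

/-- The per-block argmax set `J_i(x) = argmax_r x^{(i)}_r`. -/
def Jblock {n : ℕ} {l : Fin n → ℕ} (x : (i : Fin n) → Fin (l i) → ℝ) (i : Fin n) :
    Set (Fin (l i)) :=
  {r | ∀ r', x i r' ≤ x i r}

/-- The combined argmax set `J(x) = ∪_i {i} × J_i(x)`. -/
def Jset {n : ℕ} {l : Fin n → ℕ} (x : (i : Fin n) → Fin (l i) → ℝ) :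
    Set (Σ i : Fin n, Fin (l i)) :=
  {p | ∀ r', x p.1 r' ≤ x p.1 p.2}

def BlkAff {m : ℕ} (F : (Fin m → ℝ) → ℝ) : Prop :=
  ∀ y : Fin m → ℝ, ∑ r, y r = 1 → F y = ∑ r, y r * F (Pi.single r 1)

theorem BlkAff.const {m : ℕ} (c : ℝ) : BlkAff (fun _ : Fin m → ℝ => c) := by
  intro y hy
  simp [← Finset.sum_mul, hy]

theorem BlkAff.coord {m : ℕ} (q : Fin m) : BlkAff (fun y : Fin m → ℝ => y q) := by
  intro y _
  simp [Pi.single_apply]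

theorem BlkAff.mul_left {m : ℕ} {F : (Fin m → ℝ) → ℝ} (hF : BlkAff F) (c : ℝ) :
    BlkAff (fun y => c * F y) := by
  intro y hy
  simp only [hF y hy, Finset.mul_sum]
  exact Finset.sum_congr rfl fun r _ => by ring

theorem BlkAff.add {m : ℕ} {F G : (Fin m → ℝ) → ℝ} (hF : BlkAff F) (hG : BlkAff G) :
    BlkAff (fun y => F y + G y) := by
  intro y hy
  simp only [hF y hy, hG y hy, mul_add, Finset.sum_add_distrib]

theorem BlkAff.sum {m : ℕ} {ι : Type} (s : Finset ι) {F : ι → (Fin m → ℝ) → ℝ}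
    (hF : ∀ i, BlkAff (F i)) : BlkAff (fun y => ∑ i ∈ s, F i y) := by
  intro y hy
  simp only [Finset.mul_sum]
  rw [Finset.sum_comm]
  exact Finset.sum_congr rfl fun i _ => hF i y hy

theorem qsapF_aff {n : ℕ} {l : Fin n → ℕ}
    (a : (i : Fin n) → Fin (l i) → ℝ)
    (B : (i : Fin n) → (j : Fin n) → Matrix (Fin (l i)) (Fin (l j)) ℝ)
    (hdiag : ∀ i, B i i = 0) (z : (i : Fin n) → Fin (l i) → ℝ) (i : Fin n) :
    BlkAff (fun y => qsapF a B (Function.update z i y)) := by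
  have hc : ∀ j r, BlkAff (fun y : Fin (l i) → ℝ => Function.update z i y j r) := by
    intro j r
    by_cases h : j = i
    · subst h
      simpa using BlkAff.coord r
    · simpa [Function.update_of_ne h] using BlkAff.const (z j r)
  unfold qsapF
  refine BlkAff.add (BlkAff.mul_left ?_ _) ?_
  · refine BlkAff.sum _ fun j => BlkAff.sum _ fun k => BlkAff.sum _ fun r => BlkAff.sum _ fun s => ?_
    by_cases h : j = i
    · by_cases h' : k = i
      · subst h
        subst h'
        simpa [hdiag] using BlkAff.const (0 : ℝ)
      · have := (hc j r).mul_left (B j k r s * z k s)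
        simp only [Function.update_of_ne h']
        convert this using 2
        ring
    · simp only [Function.update_of_ne h]
      exact (hc k s).mul_left _
  · exact BlkAff.sum _ fun j => BlkAff.sum _ fun r => (hc j r).mul_left _

theorem feas_update {n : ℕ} {l : Fin n → ℕ} {z : (i : Fin n) → Fin (l i) → ℝ}
    (hz : RelaxFeas z) (i : Fin n) (r : Fin (l i)) :
    RelaxFeas (Function.update z i (Pi.single r 1)) := by
  constructor
  · intro j
    by_cases h : j = i
    · subst h
      simp
    · simpa [Function.update_of_ne h] using hz.1 j
  · intro j s
    by_cases h : j = i
    · subst h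
      simp only [Function.update_self, Pi.single_apply]
      split_ifs <;> norm_num
    · simpa [Function.update_of_ne h] using hz.2 j s

theorem min_update {n : ℕ} {l : Fin n → ℕ}
    {a : (i : Fin n) → Fin (l i) → ℝ}
    {B : (i : Fin n) → (j : Fin n) → Matrix (Fin (l i)) (Fin (l j)) ℝ}
    (hdiag : ∀ i, B i i = 0) {z : (i : Fin n) → Fin (l i) → ℝ}
    (hz : IsRelaxMin a B z) (i : Fin n) (r : Fin (l i)) (hr : 0 < z i r) :
    IsRelaxMin a B (Function.update z i (Pi.single r 1)) := by
  refine ⟨feas_update hz.1 i r, fun y hy => le_trans ?_ (hz.2 y hy)⟩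
  have h1 := qsapF_aff a B hdiag z i (z i) (hz.1.1 i)
  simp only [Function.update_eq_self] at h1
  by_contra! hlt
  have h2 : ∑ s, z i s * qsapF a B z <
      ∑ s, z i s * qsapF a B (Function.update z i (Pi.single s 1)) := by
    apply Finset.sum_lt_sum
    · intro s _
      exact mul_le_mul_of_nonneg_left (hz.2 _ (feas_update hz.1 i s)) (hz.1.2 i s)
    · exact ⟨r, Finset.mem_univ _, mul_lt_mul_of_pos_left hlt hr⟩
  rw [← Finset.sum_mul, hz.1.1 i, one_mul] at h2
  linarith

theorem min_round {n : ℕ} {l : Fin n → ℕ}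
    {a : (i : Fin n) → Fin (l i) → ℝ}
    {B : (i : Fin n) → (j : Fin n) → Matrix (Fin (l i)) (Fin (l j)) ℝ}
    (hdiag : ∀ i, B i i = 0) {z : (i : Fin n) → Fin (l i) → ℝ}
    (hz : IsRelaxMin a B z) (ρ : ∀ i, Fin (l i)) (hρ : ∀ i, 0 < z i (ρ i)) (s : Finset (Fin n)) :
    IsRelaxMin a B (fun i => if i ∈ s then Pi.single (ρ i) 1 else z i) := by
  induction s using Finset.induction_on with
  | empty => simpa using hz
  | insert j s hj ih =>
    have := min_update hdiag ih j (ρ j) (by simpa [hj] using hρ j)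
    convert this using 1
    funext i
    by_cases h : i = j
    · subst h
      simp
    · simp [Function.update_of_ne h, h]

/-- if `(x^k)_{k ∈ K}` converges to a global minimizer `z` of the
relaxation with `‖z‖₀ > n` and each block argmax `J_i(z)` a singleton, then there
are `k₀ > 0` and a global minimizer `x*` of the integer problem with
`J(x^k) = Γ(x*)` for all `k ≥ k₀`, `k ∈ K`. -/
theorem stmt7 {n : ℕ} {l : Fin n → ℕ} (hn : 1 ≤ n) (hl : ∀ i, 1 ≤ l i)
    (a : (i : Fin n) → Fin (l i) → ℝ)
    (B : (i : Fin n) → (j : Fin n) → Matrix (Fin (l i)) (Fin (l j)) ℝ)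
    (hsym : ∀ i j r s, B i j r s = B j i s r)
    (hdiag : ∀ i, B i i = 0)
    (K : Set ℕ) (hK : K.Infinite)
    (x : ℕ → ((i : Fin n) → Fin (l i) → ℝ))
    (z : (i : Fin n) → Fin (l i) → ℝ)
    (hz : IsRelaxMin a B z)
    (hconv : Filter.Tendsto x (Filter.atTop ⊓ Filter.principal K) (nhds z))
    (hz0 : n < norm0 z)
    (hJ : ∀ i, (Jblock z i).ncard = 1) :
    ∃ (k₀ : ℕ) (xstar : (i : Fin n) → Fin (l i) → ℝ),
      0 < k₀ ∧ IsIntMin a B xstar ∧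
      ∀ k, k₀ ≤ k → k ∈ K → Jset (x k) = supp xstar := by
  have h1 : ∀ i, ∃ r, Jblock z i = {r} := fun i => Set.ncard_eq_one.1 (hJ i)
  choose ρ hρ using h1
  have hmax : ∀ i r', z i r' ≤ z i (ρ i) := by
    intro i
    have : ρ i ∈ Jblock z i := by rw [hρ i]; rfl
    exact this
  have hlt : ∀ i r', r' ≠ ρ i → z i r' < z i (ρ i) := by
    intro i r' hne
    by_contra! hle
    have : r' ∈ Jblock z i := fun q => (hmax i q).trans hle
    rw [hρ i] at this
    exact hne this
  have hpos : ∀ i, 0 < z i (ρ i) := by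
    intro i
    by_contra! hle
    have h2 : ∑ r, z i r ≤ 0 := Finset.sum_nonpos fun r _ => (hmax i r).trans hle
    rw [hz.1.1 i] at h2
    linarith
  have hm := min_round hdiag hz ρ hpos Finset.univ
  simp only [Finset.mem_univ, if_true] at hm
  have hev : ∀ᶠ k in Filter.atTop ⊓ Filter.principal K,
      ∀ i r', r' ≠ ρ i → x k i r' < x k i (ρ i) := by
    rw [Filter.eventually_all]
    intro i
    rw [Filter.eventually_all]
    intro r'
    by_cases hne : r' = ρ i
    · simp [hne]
    · have hc : ∀ q, Filter.Tendsto (fun k => x k i q)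
          (Filter.atTop ⊓ Filter.principal K) (nhds (z i q)) := fun q =>
        (tendsto_pi_nhds.1 (tendsto_pi_nhds.1 hconv i) q)
      filter_upwards [(hc r').eventually_lt (hc (ρ i)) (hlt i r' hne)] with k hk _
      exact hk
  rw [Filter.eventually_inf_principal, Filter.eventually_atTop] at hev
  obtain ⟨N, hN⟩ := hev
  refine ⟨N + 1, fun i => Pi.single (ρ i) 1, Nat.succ_pos _, ⟨⟨hm.1.1, ?_⟩, ?_⟩, ?_⟩
  · intro i r
    simp only [Pi.single_apply]
    split_ifs <;> simp
  · intro y hy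
    refine hm.2 y ⟨hy.1, fun i r => ?_⟩
    rcases hy.2 i r with h | h <;> rw [h]
    norm_num
  · intro k hk hkK
    have h := hN k (by omega) hkK
    ext ⟨i, r⟩
    simp only [Jset, supp, Set.mem_setOf_eq, Pi.single_apply]
    by_cases hr : r = ρ i
    · subst hr
      simp only [if_true, zero_lt_one, iff_true]
      intro r'
      by_cases hr' : r' = ρ i
      · rw [hr']
      · exact (h i r' hr').le
    · simp only [hr, if_false, lt_irrefl, iff_false]
      intro hall
      exact absurd (hall (ρ i)) (not_le.2 (h i r hr))

end
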